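/- Let σ: A* → A* be a substitution such that σ^k is left proper or right proper for some k ≥ 1. If the language L_σ of the substitution σ is letter-balanced, then L_σ is factor-balanced. -/

import Mathlib

open List

/-- Number of occurrences of `v` as a factor of `w`, i.e. the number of
decompositions `w = p ++ v ++ s`. -/
def occ {A : Type*} [DecidableEq A] (v w : List A) : ℕ :=
  (List.range (w.length + 1)).countP (fun i => decide (v <+: w.drop i))

/-- Apply a substitution (given by its values on letters) to a word. -/
def applyS {A B : Type*} (σ : A → List B) (w : List A) : List B :=
  (w.map σ).flatten

/-- The iterate `σ^n` of a substitution `σ : A* → A*`, on letters. -/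
def iter {A : Type*} (σ : A → List A) : ℕ → A → List A
  | 0, a => [a]
  | n + 1, a => applyS σ (iter σ n a)

/-- The language of a substitution `σ`: words that are factors of `σ^n(a)` for some
letter `a`, for infinitely many `n`. -/
def LangOf {A : Type*} (σ : A → List A) : Set (List A) :=
  {w | {n : ℕ | ∃ a : A, w <:+: iter σ n a}.Infinite}

/-- A substitution is left proper if all images of letters start with the same
letter (in particular they are nonempty). -/
def LeftProper {A B : Type*} (σ : A → List B) : Prop :=
  ∃ b : B, ∀ a : A, ∃ t : List B, σ a = b :: t

/-- A substitution is right proper if all images of letters end with the same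
letter (in particular they are nonempty). -/
def RightProper {A B : Type*} (σ : A → List B) : Prop :=
  ∃ b : B, ∀ a : A, ∃ t : List B, σ a = t ++ [b]

section Occurrences

variable {A : Type*} [DecidableEq A]

theorem occ_cons (v : List A) (x : A) (w : List A) :
    occ v (x :: w) = (if v <+: x :: w then 1 else 0) + occ v w := by
  unfold occ
  rw [List.length_cons, List.range_succ_eq_map, List.countP_cons, List.countP_map, add_comm]
  simp [Function.comp_def]

theorem occ_nil {v : List A} (hv : v ≠ []) : occ v [] = 0 := by
  simp [occ, hv]

theorem occ_concat {v : List A} (hv : v ≠ []) (w : List A) (x : A) :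
    occ v (w ++ [x]) = occ v w + (if v <:+ w ++ [x] then 1 else 0) := by
  induction w with
  | nil =>
    have h : v <+: [x] ↔ v <:+ [x] := by
      rw [List.prefix_cons_iff, List.suffix_cons_iff]
      simp [hv]
    simp [occ_cons, occ_nil hv, h]
  | cons y w ih =>
    have h₁ : v <+: y :: (w ++ [x]) ↔ v = y :: (w ++ [x]) ∨ v <+: y :: w := by
      simpa using List.prefix_concat_iff (l₁ := v) (l₂ := y :: w) (a := x)
    have h₂ : v <:+ y :: (w ++ [x]) ↔ v = y :: (w ++ [x]) ∨ v <:+ w ++ [x] :=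
      List.suffix_cons_iff
    rw [List.cons_append, occ_cons, ih, occ_cons]
    rw [if_congr h₁ rfl rfl, if_congr h₂ rfl rfl]
    by_cases h : v = y :: (w ++ [x])
    · have h₃ : ¬ v <+: y :: w := fun h' => by
        have := h'.length_le
        simp [h] at this
      have h₄ : ¬ v <:+ w ++ [x] := fun h' => by
        have := h'.length_le
        simp [h] at this
      rw [if_neg h₃, if_neg h₄, if_pos (Or.inl h), if_pos (Or.inl h)]
      omega
    · simp only [h, false_or]
      omega

theorem occ_reverse {v : List A} (hv : v ≠ []) (w : List A) :
    occ v.reverse w.reverse = occ v w := by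
  induction w with
  | nil => rw [List.reverse_nil, occ_nil hv, occ_nil (by simpa using hv)]
  | cons x w ih =>
    rw [List.reverse_cons, occ_concat (by simpa using hv), ih, occ_cons, ← List.reverse_cons]
    simp only [List.reverse_suffix]
    omega

theorem occ_singleton (a : A) (w : List A) : occ [a] w = w.count a := by
  induction w with
  | nil => simp [occ_nil]
  | cons x w ih =>
    rw [occ_cons, ih, List.count_cons, add_comm]
    simp [eq_comm (a := a)]

theorem occ_le_occ_append_left (v x y : List A) : occ v y ≤ occ v (x ++ y) := by
  induction x with
  | nil => simp
  | cons a x ih => rw [List.cons_append, occ_cons]; omega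

theorem occ_append_le_length_add (v x y : List A) : occ v (x ++ y) ≤ x.length + occ v y := by
  induction x with
  | nil => simp
  | cons a x ih =>
    rw [List.cons_append, occ_cons, List.length_cons]
    split_ifs <;> omega

theorem occ_le_length {v : List A} (hv : v ≠ []) (w : List A) : occ v w ≤ w.length := by
  simpa [occ_nil hv] using occ_append_le_length_add v w []

theorem abs_occ_append_append_sub_le {v : List A} (hv : v ≠ []) (s w p : List A) :
    |(occ v (s ++ w ++ p) : ℤ) - occ v w| ≤ s.length + p.length := by
  have hr (x y : List A) : occ v (x ++ y) = occ v.reverse (y.reverse ++ x.reverse) := by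
    rw [← occ_reverse hv, List.reverse_append]
  have h₁ := occ_le_occ_append_left v s w
  have h₂ := occ_append_le_length_add v s w
  have h₃ := occ_le_occ_append_left v.reverse p.reverse (s ++ w).reverse
  have h₄ := occ_append_le_length_add v.reverse p.reverse (s ++ w).reverse
  rw [← hr, occ_reverse hv] at h₃ h₄
  rw [List.length_reverse] at h₄
  rw [abs_le]
  constructor <;> omega

/-- The occurrences of `v` starting in `x` only depend on `x` and the first `|v|` letters
that follow. -/
theorem occ_append_add_occ_take (v x : List A) {y : List A} (hy : v.length ≤ y.length) :
    occ v (x ++ y) + occ v (y.take v.length) = occ v (x ++ y.take v.length) + occ v y := by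
  induction x with
  | nil => simp [add_comm]
  | cons a x ih =>
    have h : v <+: a :: (x ++ y) ↔ v <+: a :: (x ++ y.take v.length) := by
      have hpre : a :: (x ++ y.take v.length) <+: a :: (x ++ y) :=
        List.cons_prefix_cons.2 ⟨rfl, (List.prefix_append_right_inj x).2 (List.take_prefix _ _)⟩
      refine ⟨fun h => List.prefix_of_prefix_length_le h hpre ?_, fun h => h.trans hpre⟩
      simp only [List.length_cons, List.length_append, List.length_take]
      omega
    rw [List.cons_append, List.cons_append, occ_cons, occ_cons]
    simp only [h]
    omega

end Occurrences

section Factors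

variable {A : Type*}

theorem List.prefix_append_cases {w x y : List A} (h : w <+: x ++ y) :
    w <+: x ∨ ∃ t, w = x ++ t ∧ t <+: y := by
  rcases List.prefix_or_prefix_of_prefix h (List.prefix_append x y) with h' | ⟨t, rfl⟩
  · exact Or.inl h'
  · exact Or.inr ⟨t, rfl, (List.prefix_append_right_inj x).1 h⟩

theorem List.suffix_append_cases {w x y : List A} (h : w <:+ x ++ y) :
    w <:+ y ∨ ∃ t, w = t ++ y ∧ t <:+ x := by
  rcases List.suffix_or_suffix_of_suffix h (List.suffix_append x y) with h' | ⟨t, rfl⟩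
  · exact Or.inl h'
  · exact Or.inr ⟨t, rfl, List.suffix_append_self_iff.1 h⟩

end Factors

section Substitutions

variable {A B : Type*}

@[simp] theorem applyS_nil (σ : A → List B) : applyS σ [] = [] := rfl

@[simp] theorem applyS_cons (σ : A → List B) (a : A) (w : List A) :
    applyS σ (a :: w) = σ a ++ applyS σ w := rfl

@[simp] theorem applyS_append (σ : A → List B) (u w : List A) :
    applyS σ (u ++ w) = applyS σ u ++ applyS σ w := by
  simp [applyS]

theorem applyS_singleton_self (w : List A) : applyS (fun a => [a]) w = w := by
  induction w with
  | nil => rfl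
  | cons a w ih => simp [ih]

theorem applyS_applyS (σ : A → List A) (τ : A → List A) (w : List A) :
    applyS σ (applyS τ w) = applyS (fun a => applyS σ (τ a)) w := by
  induction w with
  | nil => rfl
  | cons a w ih => simp [ih]

theorem iter_add (σ : A → List A) (m n : ℕ) (a : A) :
    iter σ (m + n) a = applyS (iter σ m) (iter σ n a) := by
  induction m with
  | zero => rw [zero_add]; exact (applyS_singleton_self _).symm
  | succ m ih =>
    rw [Nat.succ_add, _root_.iter, ih, applyS_applyS]
    rfl

theorem applyS_iter_add (σ : A → List A) (m n : ℕ) (w : List A) :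
    applyS (iter σ (m + n)) w = applyS (iter σ m) (applyS (iter σ n) w) := by
  rw [applyS_applyS]
  congr 1
  funext a
  exact iter_add σ m n a

theorem length_applyS (σ : A → List B) (w : List A) :
    ((applyS σ w).length : ℤ) = (w.map fun a => ((σ a).length : ℤ)).sum := by
  induction w with
  | nil => rfl
  | cons a w ih => simp [ih]

theorem length_le_length_applyS {σ : A → List B} (h : ∀ a, σ a ≠ []) (w : List A) :
    w.length ≤ (applyS σ w).length := by
  induction w with
  | nil => simp
  | cons a w ih =>
    have := List.length_pos_iff.2 (h a)
    simp only [applyS_cons, List.length_append, List.length_cons]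
    omega

theorem iter_mul_ne_nil {σ : A → List A} {k : ℕ} (h : ∀ a, iter σ k a ≠ []) (n : ℕ) (a : A) :
    iter σ (k * n) a ≠ [] := by
  induction n with
  | zero => simp [_root_.iter]
  | succ n ih =>
    rw [Nat.mul_succ, add_comm, iter_add]
    have := length_le_length_applyS h (iter σ (k * n) a)
    have := List.length_pos_iff.2 ih
    exact List.length_pos_iff.1 (by omega)

/-- The images under the `n`-th power of a left proper substitution agree on their first
`n` letters. -/
theorem getElem?_applyS_iter_eq {σ : A → List A} {k : ℕ} (h : LeftProper (iter σ k)) (n : ℕ) :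
    ∀ u u' : List A, ∀ i < n, ∀ x y : A, (applyS (iter σ (k * n)) u)[i]? = some x →
      (applyS (iter σ (k * n)) u')[i]? = some y → x = y := by
  obtain ⟨b, hb⟩ := h
  have hne : ∀ a, iter σ k a ≠ [] := fun a => by
    obtain ⟨t, ht⟩ := hb a
    simp [ht]
  have hsplit (n : ℕ) (a : A) (u : List A) : ∃ r, applyS (iter σ (k * (n + 1))) (a :: u) =
      iter σ (k * n) b ++ applyS (iter σ (k * n)) r := by
    obtain ⟨t, ht⟩ := hb a
    refine ⟨t ++ applyS (iter σ k) u, ?_⟩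
    rw [Nat.mul_succ, applyS_iter_add, applyS_cons, ht]
    simp
  induction n with
  | zero => intro u u' i hi; omega
  | succ n ih =>
    intro u u' i hi x y hx hy
    rcases u with _ | ⟨a, u⟩
    · simp at hx
    rcases u' with _ | ⟨a', u'⟩
    · simp at hy
    obtain ⟨r, hr⟩ := hsplit n a u
    obtain ⟨r', hr'⟩ := hsplit n a' u'
    have hpos := List.length_pos_iff.2 (iter_mul_ne_nil hne n b)
    rw [hr, List.getElem?_append] at hx
    rw [hr', List.getElem?_append] at hy
    split_ifs at hx hy with hlt
    · exact Option.some.inj (hx.symm.trans hy)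
    · exact ih r r' _ (by omega) x y hx hy

theorem exists_take_applyS_iter_eq {σ : A → List A} {k : ℕ} (h : LeftProper (iter σ k)) (n : ℕ) :
    ∃ P : List A, ∀ u, n ≤ (applyS (iter σ (k * n)) u).length →
      (applyS (iter σ (k * n)) u).take n = P := by
  by_cases hex : ∃ u, n ≤ (applyS (iter σ (k * n)) u).length
  · obtain ⟨u₀, hu₀⟩ := hex
    refine ⟨_, fun u hu => List.ext_getElem ?_ ?_ (l₂ := (applyS (iter σ (k * n)) u₀).take n)⟩
    · simp only [List.length_take]
      omega
    · intro i hi hi₀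
      rw [List.length_take] at hi hi₀
      rw [List.getElem_take, List.getElem_take]
      exact getElem?_applyS_iter_eq h n u u₀ i (by omega) _ _
        (List.getElem?_eq_getElem (by omega)) (List.getElem?_eq_getElem (by omega))
  · exact ⟨[], fun u hu => absurd ⟨u, hu⟩ hex⟩

theorem exists_applyS_of_prefix (φ : A → List B) {M : ℕ} (hM : ∀ a, (φ a).length ≤ M)
    (z : List A) {w : List B} (hw : w <+: applyS φ z) :
    ∃ u p, u <+: z ∧ w = applyS φ u ++ p ∧ p.length ≤ M := by
  induction z generalizing w with
  | nil => exact ⟨[], [], by simp_all⟩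
  | cons a z ih =>
    rcases List.prefix_append_cases hw with hw | ⟨t, rfl, ht⟩
    · exact ⟨[], w, by simp, by simp, hw.length_le.trans (hM a)⟩
    · obtain ⟨u, p, hu, rfl, hp⟩ := ih ht
      exact ⟨a :: u, p, List.cons_prefix_cons.2 ⟨rfl, hu⟩, by simp, hp⟩

theorem exists_applyS_of_infix (φ : A → List B) {M : ℕ} (hM : ∀ a, (φ a).length ≤ M)
    (z : List A) {w : List B} (hw : w <:+: applyS φ z) :
    ∃ s u p, u <:+: z ∧ w = s ++ applyS φ u ++ p ∧ s.length ≤ M ∧ p.length ≤ M := by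
  induction z with
  | nil => exact ⟨[], [], [], by simp_all⟩
  | cons a z ih =>
    obtain ⟨q, hwq, hq⟩ := List.infix_iff_prefix_suffix.1 hw
    rw [applyS_cons] at hq
    rcases List.suffix_append_cases hq with hq' | ⟨t, rfl, ht⟩
    · obtain ⟨s, u, p, hu, h⟩ := ih (hwq.isInfix.trans hq'.isInfix)
      exact ⟨s, u, p, hu.trans (List.suffix_cons a z).isInfix, h⟩
    · have htM := ht.length_le.trans (hM a)
      rcases List.prefix_append_cases hwq with hwt | ⟨r, rfl, hr⟩
      · exact ⟨w, [], [], by simp, by simp, hwt.length_le.trans htM, by simp⟩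
      · obtain ⟨u, p, hu, rfl, hp⟩ := exists_applyS_of_prefix φ hM z hr
        exact ⟨t, u, p, hu.isInfix.trans (List.suffix_cons a z).isInfix, by simp, htM, hp⟩

theorem LangOf.of_infix {σ : A → List A} {u w : List A} (hw : w ∈ LangOf σ) (hu : u <:+: w) :
    u ∈ LangOf σ :=
  Set.Infinite.mono (fun _ hn => Exists.imp (fun _ ha => hu.trans ha) hn) hw

/-- Words of the language desubstitute, up to bounded words at both ends. -/
theorem LangOf.exists_applyS [Finite A] {σ : A → List A} {m M : ℕ}
    (hne : ∀ a, iter σ m a ≠ []) (hM : ∀ a, (iter σ m a).length ≤ M)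
    {w : List A} (hw : w ∈ LangOf σ) :
    ∃ s p, ∃ u ∈ LangOf σ, w = s ++ applyS (iter σ m) u ++ p ∧ s.length ≤ M ∧ p.length ≤ M := by
  by_contra! hcon
  let S : Set (List A) := {u | u.length ≤ w.length ∧
    ∃ s p, w = s ++ applyS (iter σ m) u ++ p ∧ s.length ≤ M ∧ p.length ≤ M}
  have hS : S.Finite := (List.finite_length_le A w.length).subset fun u hu => hu.1
  have hfin : (⋃ u ∈ S, {n : ℕ | ∃ a : A, u <:+: iter σ n a}).Finite := by
    refine hS.biUnion fun u hu => ?_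
    obtain ⟨-, s, p, h, hs, hp⟩ := hu
    by_contra hinf
    exact absurd hp (not_le.2 (hcon s p u hinf h hs))
  refine hw (((Set.finite_Iio m).union (hfin.image (m + ·))).subset ?_)
  rintro n ⟨a, ha⟩
  rcases lt_or_ge n m with hlt | hge
  · exact Or.inl hlt
  obtain ⟨d, rfl⟩ := Nat.exists_eq_add_of_le hge
  rw [iter_add] at ha
  obtain ⟨s, u, p, hu, h, hs, hp⟩ := exists_applyS_of_infix _ hM _ ha
  refine Or.inr ⟨d, Set.mem_biUnion (x := u) ⟨?_, s, p, h, hs, hp⟩ ⟨a, hu⟩, rfl⟩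
  have := length_le_length_applyS hne u
  rw [h]
  simp only [List.length_append]
  omega

theorem applyS_reverse (σ : A → List B) (w : List A) :
    applyS (fun a => (σ a).reverse) w.reverse = (applyS σ w).reverse := by
  induction w with
  | nil => rfl
  | cons a w ih => simp [ih]

theorem iter_reverse (σ : A → List A) (n : ℕ) (a : A) :
    iter (fun a => (σ a).reverse) n a = (iter σ n a).reverse := by
  induction n with
  | zero => rfl
  | succ n ih => rw [_root_.iter, ih, applyS_reverse]; rfl

theorem reverse_mem_LangOf_reverse {σ : A → List A} {w : List A} :
    w.reverse ∈ LangOf (fun a => (σ a).reverse) ↔ w ∈ LangOf σ := by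
  simp only [LangOf, Set.mem_ofPred_eq, iter_reverse, List.reverse_infix]

end Substitutions

section Balance

variable {A : Type*}

theorem abs_sum_map_le {g : A → ℤ} {G : ℕ} (hG : ∀ a, |g a| ≤ G) (u : List A) :
    |(u.map g).sum| ≤ G * u.length := by
  induction u with
  | nil => simp
  | cons a u ih =>
    rw [List.map_cons, List.sum_cons, List.length_cons]
    push_cast
    have := abs_add_le (g a) (u.map g).sum
    linarith [hG a]

theorem exists_forall_abs_le [Finite A] (g : A → ℤ) : ∃ G : ℕ, ∀ a, |g a| ≤ G := by
  obtain ⟨G, hG⟩ := (Set.finite_range fun a => (g a).natAbs).bddAbove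
  refine ⟨G, fun a => ?_⟩
  have : (g a).natAbs ≤ G := hG ⟨a, rfl⟩
  rw [Int.abs_eq_natAbs]
  exact_mod_cast this

theorem abs_sum_map_sub_sum_map_le [Fintype A] [DecidableEq A] {g : A → ℤ} {C G : ℕ}
    (hG : ∀ a, |g a| ≤ G) {u u' : List A}
    (h : ∀ a, |(u.count a : ℤ) - u'.count a| ≤ C) :
    |(u.map g).sum - (u'.map g).sum| ≤ Fintype.card A * (C * G) := by
  have hsum (w : List A) : (w.map g).sum = ∑ a, (w.count a : ℤ) * g a := by
    rw [Finset.sum_list_map_count]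
    simp only [nsmul_eq_mul]
    exact Finset.sum_subset (Finset.subset_univ _) fun a _ ha => by
      simp [List.count_eq_zero_of_not_mem (by simpa using ha : a ∉ w)]
  rw [hsum, hsum, ← Finset.sum_sub_distrib]
  refine (Finset.abs_sum_le_sum_abs _ _).trans ?_
  refine (Finset.sum_le_card_nsmul _ _ (C * G : ℤ) fun a _ => ?_).trans (by simp)
  rw [← sub_mul, abs_mul]
  exact mul_le_mul (h a) (hG a) (abs_nonneg _) (by positivity)

/-- In a letter-balanced factorial language, additive functions take close values on words
whose images under a nonerasing morphism have close lengths. -/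
theorem exists_abs_sum_map_sub_le [Fintype A] [DecidableEq A] {L : Set (List A)}
    (hL : ∀ w ∈ L, ∀ u, u <:+: w → u ∈ L) {C : ℕ}
    (hC : ∀ a : A, ∀ w ∈ L, ∀ w' ∈ L, w.length = w'.length →
      |(w.count a : ℤ) - w'.count a| ≤ C)
    {φ : A → List A} (hne : ∀ a, φ a ≠ []) (g : A → ℤ) (R : ℕ) :
    ∃ D : ℤ, ∀ u ∈ L, ∀ u' ∈ L,
      |((applyS φ u).length : ℤ) - (applyS φ u').length| ≤ R →
        |(u.map g).sum - (u'.map g).sum| ≤ D := by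
  obtain ⟨G, hG⟩ := exists_forall_abs_le g
  obtain ⟨M, hM⟩ := exists_forall_abs_le fun a => ((φ a).length : ℤ)
  refine ⟨Fintype.card A * (C * G) + G * (R + Fintype.card A * (C * M)), ?_⟩
  have key : ∀ u ∈ L, ∀ u' ∈ L, u'.length ≤ u.length →
      |((applyS φ u).length : ℤ) - (applyS φ u').length| ≤ R →
        |(u.map g).sum - (u'.map g).sum| ≤
          Fintype.card A * (C * G) + G * (R + Fintype.card A * (C * M)) := by
    intro u hu u' hu' hle hR
    obtain ⟨x, y, rfl, hx⟩ : ∃ x y, u = x ++ y ∧ x.length = u'.length :=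
      ⟨u.take u'.length, u.drop u'.length, (List.take_append_drop _ _).symm, by simpa using hle⟩
    have hcount := fun a => hC a x (hL _ hu x (List.prefix_append x y).isInfix) u' hu' hx
    have h₁ := abs_sum_map_sub_sum_map_le hG hcount
    have h₂ := abs_sum_map_sub_sum_map_le hM hcount
    rw [← length_applyS, ← length_applyS] at h₂
    have h₃ := length_le_length_applyS hne y
    have h₄ := abs_sum_map_le hG y
    rw [applyS_append, List.length_append] at hR
    push_cast at hR
    have h₅ : (y.length : ℤ) ≤ R + Fintype.card A * (C * M) := by
      rw [abs_le] at hR h₂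
      zify at h₃
      linarith
    have h₆ := mul_le_mul_of_nonneg_left h₅ (Int.natCast_nonneg G)
    rw [List.map_append, List.sum_append, add_sub_right_comm]
    exact (abs_add_le _ _).trans (by linarith)
  intro u hu u' hu' hR
  rcases le_total u'.length u.length with hle | hle
  · exact key u hu u' hu' hle hR
  · rw [abs_sub_comm] at hR ⊢
    exact key u' hu' u hu hle hR

/-- Up to a bounded error, the number of occurrences of `v` in an image is additive. -/
theorem exists_abs_occ_applyS_sub_sum_le [Finite A] [DecidableEq A] {v : List A} (hv : v ≠ [])
    {φ : A → List A} (hne : ∀ a, φ a ≠ []) {P : List A}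
    (hP : ∀ u, v.length ≤ (applyS φ u).length → (applyS φ u).take v.length = P) :
    ∃ (g : A → ℤ) (K : ℕ), ∀ u, |(occ v (applyS φ u) : ℤ) - (u.map g).sum| ≤ K := by
  let g : A → ℤ := fun a => occ v (φ a ++ P) - occ v P
  obtain ⟨G, hG⟩ := exists_forall_abs_le g
  obtain ⟨M, hM⟩ := exists_forall_abs_le fun a => ((φ a).length : ℤ)
  refine ⟨g, M + v.length + G * (1 + v.length), fun u => ?_⟩
  push_cast
  induction u with
  | nil =>
    simp only [applyS_nil, occ_nil hv, List.map_nil, List.sum_nil]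
    norm_num
    positivity
  | cons a u ih =>
    rcases le_or_gt v.length (applyS φ u).length with hlen | hlen
    · have h := occ_append_add_occ_take v (φ a) hlen
      rw [hP u hlen] at h
      have hga : (occ v (applyS φ (a :: u)) : ℤ) - ((a :: u).map g).sum =
          occ v (applyS φ u) - (u.map g).sum := by
        rw [List.map_cons, List.sum_cons, applyS_cons]
        simp only [g]
        zify at h
        linarith
      rwa [hga]
    · have h₁ := occ_le_length hv (applyS φ (a :: u))
      have h₂ := length_le_length_applyS hne u
      have h₃ := abs_sum_map_le hG (a :: u)
      have h₄ := hM a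
      rw [abs_of_nonneg (Int.natCast_nonneg _)] at h₄
      rw [applyS_cons, List.length_append] at h₁
      have h₅ : (occ v (applyS φ (a :: u)) : ℤ) ≤ M + v.length := by
        rw [applyS_cons]
        omega
      have h₆ : ((a :: u).length : ℤ) ≤ 1 + v.length := by
        rw [List.length_cons]
        omega
      have h₇ := mul_le_mul_of_nonneg_left h₆ (Int.natCast_nonneg G)
      refine (abs_sub _ _).trans ?_
      rw [abs_of_nonneg (Int.natCast_nonneg _)]
      linarith

theorem exists_abs_occ_sub_le_of_leftProper [Fintype A] [DecidableEq A] {σ : A → List A} {k : ℕ}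
    (hσ : LeftProper (iter σ k)) {C : ℕ}
    (hC : ∀ a : A, ∀ w ∈ LangOf σ, ∀ w' ∈ LangOf σ, w.length = w'.length →
      |(occ [a] w : ℤ) - occ [a] w'| ≤ C)
    {v : List A} (hv : v ≠ []) :
    ∃ D : ℕ, ∀ w ∈ LangOf σ, ∀ w' ∈ LangOf σ, w.length = w'.length →
      |(occ v w : ℤ) - occ v w'| ≤ D := by
  have hne : ∀ a, iter σ (k * v.length) a ≠ [] := iter_mul_ne_nil (fun a => by
    obtain ⟨b, hb⟩ := hσ
    obtain ⟨t, ht⟩ := hb a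
    simp [ht]) _
  obtain ⟨P, hP⟩ := exists_take_applyS_iter_eq hσ v.length
  obtain ⟨g, K, hK⟩ := exists_abs_occ_applyS_sub_sum_le hv hne hP
  obtain ⟨M, hM⟩ := exists_forall_abs_le fun a => ((iter σ (k * v.length) a).length : ℤ)
  have hM' : ∀ a, (iter σ (k * v.length) a).length ≤ M := fun a => by
    have := hM a
    rw [abs_of_nonneg (Int.natCast_nonneg _)] at this
    exact_mod_cast this
  simp only [occ_singleton] at hC
  obtain ⟨D, hD⟩ := exists_abs_sum_map_sub_le (fun w hw u hu => LangOf.of_infix hw hu) hC hne g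
    (2 * M)
  refine ⟨(D + 2 * (K + 2 * M)).toNat, fun w hw w' hw' hlen => ?_⟩
  obtain ⟨s, p, u, hu, rfl, hs, hp⟩ := LangOf.exists_applyS hne hM' hw
  obtain ⟨s', p', u', hu', rfl, hs', hp'⟩ := LangOf.exists_applyS hne hM' hw'
  simp only [List.length_append] at hlen
  have h₁ := hD u hu u' hu' (by rw [abs_le]; push_cast; constructor <;> omega)
  have h₂ := hK u
  have h₃ := hK u'
  have h₄ := abs_occ_append_append_sub_le hv s (applyS (iter σ (k * v.length)) u) p
  have h₅ := abs_occ_append_append_sub_le hv s' (applyS (iter σ (k * v.length)) u') p'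
  refine le_trans ?_ (Int.self_le_toNat _)
  rw [abs_le] at *
  constructor <;> omega

theorem exists_abs_occ_sub_le_of_rightProper [Fintype A] [DecidableEq A] {σ : A → List A} {k : ℕ}
    (hσ : RightProper (iter σ k)) {C : ℕ}
    (hC : ∀ a : A, ∀ w ∈ LangOf σ, ∀ w' ∈ LangOf σ, w.length = w'.length →
      |(occ [a] w : ℤ) - occ [a] w'| ≤ C)
    {v : List A} (hv : v ≠ []) :
    ∃ D : ℕ, ∀ w ∈ LangOf σ, ∀ w' ∈ LangOf σ, w.length = w'.length →
      |(occ v w : ℤ) - occ v w'| ≤ D := by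
  have hleft : LeftProper (iter (fun a => (σ a).reverse) k) := by
    obtain ⟨b, hb⟩ := hσ
    refine ⟨b, fun a => ?_⟩
    obtain ⟨t, ht⟩ := hb a
    exact ⟨t.reverse, by rw [iter_reverse, ht]; simp⟩
  have hmem {w : List A} (hw : w ∈ LangOf fun a => (σ a).reverse) : w.reverse ∈ LangOf σ := by
    rwa [← reverse_mem_LangOf_reverse, List.reverse_reverse]
  obtain ⟨D, hD⟩ := exists_abs_occ_sub_le_of_leftProper hleft (C := C)
    (fun a w hw w' hw' hlen => by
      simpa only [occ_singleton, List.count_reverse] using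
        hC a _ (hmem hw) _ (hmem hw') (by simpa using hlen))
    (v := v.reverse) (by simpa using hv)
  refine ⟨D, fun w hw w' hw' hlen => ?_⟩
  simpa only [occ_reverse hv] using hD _ (reverse_mem_LangOf_reverse.2 hw) _
    (reverse_mem_LangOf_reverse.2 hw') (by simpa using hlen)

end Balance

/-- if `σ^k` is left or right proper for some `k ≥ 1` and the language
`L_σ` of the substitution `σ` is letter-balanced, then `L_σ` is factor-balanced. -/
theorem factor_balanced_of_proper_substitution {A : Type*} [Fintype A] [DecidableEq A]
    (σ : A → List A)
    (hproper : ∃ k : ℕ, 1 ≤ k ∧ (LeftProper (iter σ k) ∨ RightProper (iter σ k)))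
    (hbal : ∃ C : ℕ, ∀ a : A, ∀ w ∈ LangOf σ, ∀ w' ∈ LangOf σ,
      w.length = w'.length →
        |(occ [a] w : ℤ) - (occ [a] w' : ℤ)| ≤ (C : ℤ)) :
    ∀ n : ℕ, 1 ≤ n → ∃ C : ℕ, ∀ v : List A, v.length = n →
      ∀ w ∈ LangOf σ, ∀ w' ∈ LangOf σ, w.length = w'.length →
        |(occ v w : ℤ) - (occ v w' : ℤ)| ≤ (C : ℤ) := by
  intro n hn
  obtain ⟨k, -, hk⟩ := hproper
  obtain ⟨C, hC⟩ := hbal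
  have hex : ∀ v : List A, ∃ D : ℕ, v.length = n → ∀ w ∈ LangOf σ, ∀ w' ∈ LangOf σ,
      w.length = w'.length → |(occ v w : ℤ) - occ v w'| ≤ D := by
    intro v
    by_cases hv : v.length = n
    · have hv' : v ≠ [] := List.length_pos_iff.1 (by omega)
      obtain ⟨D, hD⟩ := hk.elim (exists_abs_occ_sub_le_of_leftProper · hC hv')
        (exists_abs_occ_sub_le_of_rightProper · hC hv')
      exact ⟨D, fun _ => hD⟩
    · exact ⟨0, fun h => absurd h hv⟩
  choose D hD using hex
  obtain ⟨B, hB⟩ := ((List.finite_length_eq A n).image D).bddAbove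
  refine ⟨B, fun v hv w hw w' hw' hlen => (hD v hv w hw w' hw' hlen).trans ?_⟩
  exact_mod_cast hB ⟨v, hv, rfl⟩
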